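/- Monotonicity of the part metric along solutions (nonlocal dispersal case). Assume f satisfies (H0). Let u and v be solutions of (E_f) on [0,∞) with inf_x u(0,x) > 0 and inf_x v(0,x) > 0. Then for every t ≥ 0 one has inf_x u(t,x) > 0 and inf_x v(t,x) > 0, and for all 0 ≤ s ≤ t, ρ(u(t,·), v(t,·)) ≤ ρ(u(s,·), v(s,·)). -/

import Mathlib

open MeasureTheory Set Filter RealInnerProductSpace

noncomputable section

abbrev Euc (N : ℕ) := EuclideanSpace ℝ (Fin N)

/-- Membership in `X`: bounded and uniformly continuous real functions on `ℝ^N`. -/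
def MemX {N : ℕ} (u : Euc N → ℝ) : Prop :=
  UniformContinuous u ∧ ∃ C, ∀ x, |u x| ≤ C

/-- Hypotheses on the convolution kernel `κ`. -/
def KernelHyp {N : ℕ} (κ : Euc N → ℝ) : Prop :=
  Continuous κ ∧ (∀ z, 0 ≤ κ z) ∧ HasCompactSupport κ ∧ 0 < κ 0 ∧ (∫ z, κ z) = 1

/-- Hypothesis (H0) on the nonlinearity `f`. -/
def SatH0 {N : ℕ} (T M₀ : ℝ) (f : ℝ → Euc N → ℝ → ℝ) : Prop :=
  (∀ t x u, f (t + T) x u = f t x u) ∧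
  (∀ x : Euc N, ContDiff ℝ 1 (fun p : ℝ × ℝ => f p.1 x p.2)) ∧
  (∀ R : ℝ, 0 < R →
    (∃ C, ∀ t x u, |u| ≤ R →
      |f t x u| + |deriv (fun s => f s x u) t| + |deriv (fun v => f t x v) u| ≤ C) ∧
    UniformContinuousOn (fun p : ℝ × Euc N × ℝ => f p.1 p.2.1 p.2.2)
      {p : ℝ × Euc N × ℝ | |p.2.2| ≤ R} ∧
    UniformContinuousOn (fun p : ℝ × Euc N × ℝ => deriv (fun s => f s p.2.1 p.2.2) p.1)
      {p : ℝ × Euc N × ℝ | |p.2.2| ≤ R} ∧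
    UniformContinuousOn (fun p : ℝ × Euc N × ℝ => deriv (fun v => f p.1 p.2.1 v) p.2.2)
      {p : ℝ × Euc N × ℝ | |p.2.2| ≤ R}) ∧
  (∀ t x u, M₀ ≤ u → f t x u < 0) ∧
  (∀ a b : ℝ, 0 ≤ a → a ≤ b → ∃ c < (0:ℝ), ∀ t x u, a ≤ u → u ≤ b →
    deriv (fun v => f t x v) u ≤ c)

/-- Right-hand side of the nonlocal dispersal KPP equation (E_g). -/
def RHS {N : ℕ} (κ : Euc N → ℝ) (g : ℝ → Euc N → ℝ → ℝ)
    (u : ℝ → Euc N → ℝ) (t : ℝ) (x : Euc N) : ℝ :=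
  (∫ y, κ (y - x) * u t y) - u t x + u t x * g t x (u t x)

/-- A solution of (E_g) on the interval `I`. -/
def IsSol {N : ℕ} (κ : Euc N → ℝ) (g : ℝ → Euc N → ℝ → ℝ)
    (u : ℝ → Euc N → ℝ) (I : Set ℝ) : Prop :=
  ContinuousOn (fun p : ℝ × Euc N => u p.1 p.2) (I ×ˢ univ) ∧
  (∀ t ∈ I, MemX (u t)) ∧
  (∀ J : Set ℝ, J ⊆ I → IsCompact J → ∃ C, ∀ t ∈ J, ∀ x, |u t x| ≤ C) ∧
  (∀ x : Euc N, ∀ t ∈ interior I, HasDerivAt (fun s => u s x) (RHS κ g u t x) t)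

/-- A time periodic strictly positive solution of (E_g). -/
def PeriodicPosSol {N : ℕ} (κ : Euc N → ℝ) (g : ℝ → Euc N → ℝ → ℝ) (T : ℝ)
    (u : ℝ → Euc N → ℝ) : Prop :=
  IsSol κ g u univ ∧ (∀ t x, u (t + T) x = u t x) ∧ ∃ δ > 0, ∀ t x, δ ≤ u t x

/-- The part metric between two strictly positive bounded functions. -/
def PartMetric {N : ℕ} (u v : Euc N → ℝ) : ℝ :=
  sInf (Real.log '' {α : ℝ | 1 ≤ α ∧ ∀ x, u x / α ≤ v x ∧ v x ≤ α * u x})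

/-- Hypothesis (H1): `f` is asymptotically (in space) equal to the time and space
periodic nonlinearity `f₀`. -/
def SatH1 {N : ℕ} (T M₀ : ℝ) (p : Fin N → ℝ) (f f₀ : ℝ → Euc N → ℝ → ℝ) : Prop :=
  SatH0 T M₀ f₀ ∧ (∀ i, 0 < p i) ∧
  (∀ i t x u, f₀ t (x + p i • EuclideanSpace.single i (1:ℝ)) u = f₀ t x u) ∧
  (∀ R : ℝ, 0 < R → ∀ ε : ℝ, 0 < ε → ∃ ρ : ℝ, ∀ t x u, ρ ≤ ‖x‖ → |u| ≤ R →
    |f t x u - f₀ t x u| ≤ ε)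

/-- A time and space periodic positive solution of (E_g) (period `T` in time and
periods `pᵢ` in the spatial coordinate directions). -/
def PeriodicMediaSol {N : ℕ} (κ : Euc N → ℝ) (g : ℝ → Euc N → ℝ → ℝ) (T : ℝ)
    (p : Fin N → ℝ) (u : ℝ → Euc N → ℝ) : Prop :=
  IsSol κ g u univ ∧ (∀ t x, u (t + T) x = u t x) ∧
  (∀ i t x, u t (x + p i • EuclideanSpace.single i (1:ℝ)) = u t x) ∧
  (∀ t x, 0 < u t x)

/-- The class `X⁺(ξ)` of front-like nonnegative initial data in the direction `ξ`. -/
def XplusXi {N : ℕ} (ξ : Euc N) (u : Euc N → ℝ) : Prop :=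
  MemX u ∧ (∀ x, 0 ≤ u x) ∧
  (∃ m > 0, ∃ r : ℝ, ∀ x, ⟪x, ξ⟫ ≤ r → m ≤ u x) ∧
  (∃ r₀ : ℝ, ∀ x, r₀ ≤ ⟪x, ξ⟫ → u x = 0)


lemma kint {N : ℕ} {κ : Euc N → ℝ} (hκ : KernelHyp κ) (x : Euc N) (w : Euc N → ℝ)
    (hw : Continuous w) : Integrable (fun y => κ (y - x) * w y) := by
  obtain ⟨h1, h2, h3, h4, h5⟩ := hκ
  apply Continuous.integrable_of_hasCompactSupport
  · fun_prop
  · apply HasCompactSupport.mul_right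
    exact h3.comp_homeomorph (Homeomorph.subRight x)

lemma kone {N : ℕ} {κ : Euc N → ℝ} (hκ : KernelHyp κ) (x : Euc N) (c : ℝ) :
    (∫ y, κ (y - x) * c) = c := by
  rw [integral_mul_const, integral_sub_right_eq_self κ x, hκ.2.2.2.2, one_mul]

lemma kge {N : ℕ} {κ : Euc N → ℝ} (hκ : KernelHyp κ) (x : Euc N) (w : Euc N → ℝ)
    (hw : Continuous w) (c : ℝ) (h : ∀ y, c ≤ w y) : c ≤ ∫ y, κ (y - x) * w y := by
  rw [← kone hκ x c]
  apply integral_mono (kint hκ x _ continuous_const) (kint hκ x w hw)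
  intro y
  exact mul_le_mul_of_nonneg_left (h y) (hκ.2.1 _)

lemma comp_step {N : ℕ} {κ : Euc N → ℝ} (hκ : KernelHyp κ) (w w' : ℝ → Euc N → ℝ)
    (s t1 A : ℝ)
    (hc : ∀ x, ContinuousOn (fun t => w t x) (Icc s t1))
    (hcx : ∀ t ∈ Icc s t1, Continuous (w t))
    (hd : ∀ x, ∀ t ∈ Ioo s t1, HasDerivAt (fun r => w r x) (w' t x) t)
    (hi : ∀ x, ∀ t ∈ Ioo s t1, w t x < 0 →
      (∫ y, κ (y - x) * w t y) - A * |w t x| ≤ w' t x)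
    (h0 : ∀ x, 0 ≤ w s x) (D : ℝ) (hD : 0 < D)
    (hb : ∀ t ∈ Icc s t1, ∀ x, -(D * Real.exp ((A + 3) * (t - s))) ≤ w t x) :
    ∀ t ∈ Icc s t1, ∀ x, -(D / 2 * Real.exp ((A + 3) * (t - s))) ≤ w t x := by
  intro t ht x
  set ψ : ℝ → ℝ := fun r => -(D / 2 * Real.exp ((A + 3) * (r - s))) with hψ
  have hψc : Continuous ψ := by fun_prop
  have hψd : ∀ r, HasDerivAt ψ (-(D / 2 * (Real.exp ((A + 3) * (r - s)) * (A + 3)))) r := by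
    intro r
    have h1 : HasDerivAt (fun r => (A + 3) * (r - s)) (A + 3) r := by
      simpa using ((hasDerivAt_id r).sub_const s).const_mul (A + 3)
    exact (h1.exp.const_mul (D / 2)).neg
  rcases eq_or_lt_of_le ht.1 with h | hst
  · subst h
    have := h0 x
    have h2 : ψ s < 0 := by simp [hψ]; positivity
    exact h2.le.trans this
  -- near the left end
  have hev : ∀ᶠ r in nhdsWithin s (Ioi s), ψ r < w r x := by
    have h2 : ψ s < w s x := by
      have : ψ s < 0 := by simp [hψ]; positivity
      exact this.trans_le (h0 x)
    have h3 : Tendsto (fun r => w r x) (nhdsWithin s (Ioi s)) (nhds (w s x)) := by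
      have := (hc x) s ⟨le_rfl, ht.1.trans ht.2⟩
      refine this.mono_left ?_
      rw [← nhdsWithin_Ioo_eq_nhdsGT (hst.trans_le ht.2)]
      exact nhdsWithin_mono _ Ioo_subset_Icc_self
    exact (hψc.continuousWithinAt (s := Ioi s) (x := s)).eventually_lt h3 h2
  obtain ⟨η, hη, hη2⟩ := (hev.and (Ioo_mem_nhdsGT hst)).exists
  refine image_le_of_deriv_right_lt_deriv_boundary' (f := ψ)
    (f' := fun r => -(D / 2 * (Real.exp ((A + 3) * (r - s)) * (A + 3))))
    (B := fun r => w r x) (B' := fun r => w' r x) (a := η) (b := t)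
    hψc.continuousOn (fun r _ => (hψd r).hasDerivWithinAt) hη.le
    ((hc x).mono (Icc_subset_Icc hη2.1.le ht.2)) ?_ ?_ ⟨hη2.2.le, le_rfl⟩
  · intro r hr
    exact (hd x r ⟨hη2.1.trans_le hr.1, hr.2.trans_le ht.2⟩).hasDerivWithinAt
  · intro r hr heq
    have hr' : r ∈ Ioo s t1 := ⟨hη2.1.trans_le hr.1, hr.2.trans_le ht.2⟩
    have hrI := Ioo_subset_Icc_self hr'
    have hE := Real.exp_pos ((A + 3) * (r - s))
    have hneg : ψ r < 0 := by simp only [hψ]; rw [neg_lt_zero]; positivity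
    have heq' : w r x = ψ r := heq.symm
    have h1 := hi x r hr' (by rw [heq']; exact hneg)
    have h2 := kge hκ x (w r) (hcx r hrI) _ (hb r hrI)
    rw [heq', abs_of_neg hneg] at h1
    simp only [hψ] at h1
    have : 0 < D * Real.exp ((A + 3) * (r - s)) := by positivity
    show -(D / 2 * (Real.exp ((A + 3) * (r - s)) * (A + 3))) < w' r x
    nlinarith

lemma comp_main {N : ℕ} {κ : Euc N → ℝ} (hκ : KernelHyp κ) (w w' : ℝ → Euc N → ℝ)
    (s t1 A C : ℝ) (hA : 0 ≤ A)
    (hc : ∀ x, ContinuousOn (fun t => w t x) (Icc s t1))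
    (hcx : ∀ t ∈ Icc s t1, Continuous (w t))
    (hb : ∀ t ∈ Icc s t1, ∀ x, |w t x| ≤ C)
    (hd : ∀ x, ∀ t ∈ Ioo s t1, HasDerivAt (fun r => w r x) (w' t x) t)
    (hi : ∀ x, ∀ t ∈ Ioo s t1, w t x < 0 →
      (∫ y, κ (y - x) * w t y) - A * |w t x| ≤ w' t x)
    (h0 : ∀ x, 0 ≤ w s x) :
    ∀ t ∈ Icc s t1, ∀ x, 0 ≤ w t x := by
  have key : ∀ n : ℕ, ∀ t ∈ Icc s t1, ∀ x,
      -((|C| + 1) * (1 / 2) ^ n * Real.exp ((A + 3) * (t - s))) ≤ w t x := by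
    intro n
    induction n with
    | zero =>
      intro t ht x
      have h1 := neg_le_of_abs_le ((hb t ht x).trans (le_abs_self C))
      have h2 : 1 ≤ Real.exp ((A + 3) * (t - s)) :=
        Real.one_le_exp (mul_nonneg (by linarith) (by linarith [ht.1]))
      have h3 := abs_nonneg C
      simp only [pow_zero, mul_one]
      nlinarith
    | succ n ih =>
      have := comp_step hκ w w' s t1 A hc hcx hd hi h0 ((|C| + 1) * (1 / 2) ^ n)
        (by positivity) ih
      intro t ht x
      convert this t ht x using 3
      ring
  intro t ht x
  have hlim : Tendsto (fun n : ℕ => -((|C| + 1) * (1 / 2) ^ n * Real.exp ((A + 3) * (t - s))))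
      atTop (nhds 0) := by
    have := (((tendsto_pow_atTop_nhds_zero_of_lt_one (r := (1 / 2 : ℝ)) (by norm_num)
      (by norm_num)).const_mul (|C| + 1)).mul_const (Real.exp ((A + 3) * (t - s)))).neg
    simpa using this
  exact le_of_tendsto' hlim (fun n => key n t ht x)

lemma sol_cont_t {N : ℕ} {κ : Euc N → ℝ} {f : ℝ → Euc N → ℝ → ℝ} {u : ℝ → Euc N → ℝ}
    (hu : IsSol κ f u (Set.Ici 0)) (x : Euc N) : ContinuousOn (fun t => u t x) (Ici 0) :=
  hu.1.comp (f := fun t : ℝ => (t, x)) (by fun_prop) (fun t ht => ⟨ht, mem_univ _⟩)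

lemma sol_bdd {N : ℕ} {κ : Euc N → ℝ} {f : ℝ → Euc N → ℝ → ℝ} {u : ℝ → Euc N → ℝ}
    (hu : IsSol κ f u (Set.Ici 0)) (t : ℝ) :
    ∃ C > 0, ∀ r ∈ Icc 0 t, ∀ x, |u r x| ≤ C := by
  obtain ⟨C, hC⟩ := hu.2.2.1 (Icc 0 t) Icc_subset_Ici_self isCompact_Icc
  exact ⟨|C| + 1, by positivity, fun r hr x => by linarith [hC r hr x, le_abs_self C]⟩

lemma f_bdd {N : ℕ} {T M₀ : ℝ} {f : ℝ → Euc N → ℝ → ℝ} (hf : SatH0 T M₀ f) (R : ℝ) (hR : 0 < R) :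
    ∃ C ≥ 0, ∀ t x u, |u| ≤ R → |f t x u| ≤ C := by
  obtain ⟨⟨C, hC⟩, -⟩ := hf.2.2.1 R hR
  refine ⟨|C|, abs_nonneg _, fun t x u hu => ?_⟩
  have := hC t x u hu
  linarith [le_abs_self C, abs_nonneg (deriv (fun s => f s x u) t),
    abs_nonneg (deriv (fun v => f t x v) u)]

lemma f_anti {N : ℕ} {T M₀ : ℝ} {f : ℝ → Euc N → ℝ → ℝ} (hf : SatH0 T M₀ f) (t : ℝ) (x : Euc N)
    (a b : ℝ) (ha : 0 ≤ a) (hab : a ≤ b) : f t x b ≤ f t x a := by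
  have hcd : ContDiff ℝ 1 (fun v => f t x v) :=
    (hf.2.1 x).comp (contDiff_const.prodMk contDiff_id : ContDiff ℝ 1 (fun v : ℝ => (t, v)))
  obtain ⟨c, hc, h⟩ := hf.2.2.2.2 a b ha hab
  refine antitoneOn_of_deriv_nonpos (convex_Icc a b) hcd.continuous.continuousOn
    (hcd.differentiable (by norm_num)).differentiableOn ?_ (left_mem_Icc.2 hab)
    (right_mem_Icc.2 hab) hab
  intro y hy
  have hy := interior_subset hy
  exact (h t x y hy.1 hy.2).trans hc.le

lemma sol_pos {N : ℕ} {T M₀ : ℝ} {κ : Euc N → ℝ} (hκ : KernelHyp κ)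
    {f : ℝ → Euc N → ℝ → ℝ} (hf : SatH0 T M₀ f) {u : ℝ → Euc N → ℝ}
    (hu : IsSol κ f u (Set.Ici 0)) (hu0 : ∃ δ > 0, ∀ x, δ ≤ u 0 x) (t : ℝ) (ht : 0 ≤ t) :
    ∃ δ > 0, ∀ x, δ ≤ u t x := by
  obtain ⟨δ, hδ, h0⟩ := hu0
  obtain ⟨R, hR, hub⟩ := sol_bdd hu t
  obtain ⟨C, hC, hfb⟩ := f_bdd hf R hR
  have hE : ∀ r : ℝ, HasDerivAt (fun r => δ * Real.exp (-(1 + C) * r))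
      (δ * (Real.exp (-(1 + C) * r) * (-(1 + C)))) r := by
    intro r
    have h1 : HasDerivAt (fun r => -(1 + C) * r) (-(1 + C)) r := by
      simpa using (hasDerivAt_id r).const_mul (-(1 + C))
    exact h1.exp.const_mul δ
  have main := comp_main hκ (fun r x => u r x - δ * Real.exp (-(1 + C) * r))
    (fun r x => RHS κ f u r x - δ * (Real.exp (-(1 + C) * r) * (-(1 + C)))) 0 t (1 + C) (R + δ)
    (by linarith) ?_ ?_ ?_ ?_ ?_ ?_ t ⟨ht, le_rfl⟩
  · exact ⟨δ * Real.exp (-(1 + C) * t), by positivity, fun x => by linarith [main x]⟩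
  · intro x
    exact ((sol_cont_t hu x).mono Icc_subset_Ici_self).sub (by fun_prop)
  · intro r hr
    exact ((hu.2.1 r hr.1).1.continuous).sub continuous_const
  · intro r hr x
    have h1 := hub r hr x
    have h2 : Real.exp (-(1 + C) * r) ≤ 1 := by
      rw [Real.exp_le_one_iff]; nlinarith [hr.1]
    have h3 := Real.exp_pos (-(1 + C) * r)
    have h4 : |δ * Real.exp (-(1 + C) * r)| ≤ δ := by
      rw [abs_of_pos (by positivity)]; nlinarith
    exact (abs_sub _ _).trans (by linarith)
  · intro x r hr
    exact (hu.2.2.2 x r (by rw [interior_Ici]; exact hr.1)).sub (hE r)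
  · intro x r hr _
    have hrI := Ioo_subset_Icc_self hr
    have hpos : 0 < δ * Real.exp (-(1 + C) * r) := by positivity
    have hcu := (hu.2.1 r hrI.1).1.continuous
    have hsplit : (∫ y, κ (y - x) * (u r y - δ * Real.exp (-(1 + C) * r)))
        = (∫ y, κ (y - x) * u r y) - δ * Real.exp (-(1 + C) * r) := by
      simp_rw [mul_sub]
      rw [integral_sub (kint hκ x _ hcu) (kint hκ x _ continuous_const), kone hκ]
    have h1 : |u r x * f r x (u r x)| ≤ C * |u r x| := by
      rw [abs_mul, mul_comm]
      exact mul_le_mul_of_nonneg_right (hfb r x _ (hub r hrI x)) (abs_nonneg _)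
    have h2 := neg_abs_le (u r x * f r x (u r x))
    have h3 := le_abs_self (u r x)
    have h4 : |u r x| ≤ |u r x - δ * Real.exp (-(1 + C) * r)| + δ * Real.exp (-(1 + C) * r) := by
      have := abs_add_le (u r x - δ * Real.exp (-(1 + C) * r)) (δ * Real.exp (-(1 + C) * r))
      rwa [sub_add_cancel, abs_of_pos hpos] at this
    have h5 := mul_le_mul_of_nonneg_left h4 (by linarith : 0 ≤ 1 + C)
    simp only [hsplit, RHS]
    linarith
  · intro x
    simpa using h0 x

lemma sol_cmp {N : ℕ} {T M₀ : ℝ} {κ : Euc N → ℝ} (hκ : KernelHyp κ)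
    {f : ℝ → Euc N → ℝ → ℝ} (hf : SatH0 T M₀ f) {u v : ℝ → Euc N → ℝ}
    (hu : IsSol κ f u (Set.Ici 0)) (hv : IsSol κ f v (Set.Ici 0))
    (hup : ∀ t ≥ 0, ∀ x, 0 < u t x)
    (α : ℝ) (hα : 1 ≤ α) (s t : ℝ) (hs : 0 ≤ s) (hst : s ≤ t)
    (h : ∀ x, v s x ≤ α * u s x) (x : Euc N) : v t x ≤ α * u t x := by
  obtain ⟨R, hR, hub⟩ := sol_bdd hu t
  obtain ⟨R', hR', hvb⟩ := sol_bdd hv t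
  obtain ⟨C, hC, hfb⟩ := f_bdd hf R' hR'
  have main := comp_main hκ (fun r x => α * u r x - v r x)
    (fun r x => α * RHS κ f u r x - RHS κ f v r x) s t C (α * R + R') hC
    ?_ ?_ ?_ ?_ ?_ ?_ t ⟨hst, le_rfl⟩ x
  · linarith
  · intro x
    have hsub : Icc s t ⊆ Ici 0 := fun r hr => hs.trans hr.1
    exact (continuousOn_const.mul ((sol_cont_t hu x).mono hsub)).sub ((sol_cont_t hv x).mono hsub)
  · intro r hr
    have hr0 : 0 ≤ r := hs.trans hr.1
    exact (continuous_const.mul (hu.2.1 r hr0).1.continuous).sub (hv.2.1 r hr0).1.continuous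
  · intro r hr x
    have hr0 : 0 ≤ r := hs.trans hr.1
    have h1 := hub r ⟨hr0, hr.2⟩ x
    have h2 := hvb r ⟨hr0, hr.2⟩ x
    have h3 : |α * u r x| ≤ α * R := by
      rw [abs_mul, abs_of_pos (by linarith)]
      exact mul_le_mul_of_nonneg_left h1 (by linarith)
    exact (abs_sub _ _).trans (by linarith)
  · intro x r hr
    have hr0 : r ∈ interior (Ici (0:ℝ)) := by rw [interior_Ici]; exact hs.trans_lt hr.1
    exact ((hu.2.2.2 x r hr0).const_mul α).sub (hv.2.2.2 x r hr0)
  · intro x r hr hneg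
    have hr0 : 0 ≤ r := hs.trans hr.1.le
    have hcu := (hu.2.1 r hr0).1.continuous
    have hcv := (hv.2.1 r hr0).1.continuous
    have hsplit : (∫ y, κ (y - x) * (α * u r y - v r y))
        = α * (∫ y, κ (y - x) * u r y) - ∫ y, κ (y - x) * v r y := by
      rw [← integral_const_mul, ← integral_sub ((kint hκ x _ hcu).const_mul α) (kint hκ x _ hcv)]
      congr 1
      ext y
      ring
    have hp := hup r hr0 x
    have hle : u r x ≤ α * u r x := by nlinarith
    have hneg' : α * u r x - v r x < 0 := hneg
    have ha := f_anti hf r x (u r x) (v r x) hp.le (by linarith)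
    have h1 : α * u r x * f r x (v r x) ≤ α * u r x * f r x (u r x) :=
      mul_le_mul_of_nonneg_left ha (by positivity)
    have h2 := (le_abs_self _).trans (hfb r x _ (hvb r ⟨hr0, hr.2.le⟩ x))
    have h3 : C * (α * u r x - v r x) ≤ f r x (v r x) * (α * u r x - v r x) :=
      mul_le_mul_of_nonpos_right h2 hneg'.le
    simp only [hsplit, RHS, abs_of_neg hneg']
    linarith
  · intro x
    have := h x
    show 0 ≤ α * u s x - v s x
    linarith

/-- monotonicity of the part metric along solutions. -/
theorem stmt7 {N : ℕ} (hN : 1 ≤ N) (T M₀ : ℝ) (hT : 0 < T) (hM₀ : 0 < M₀)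
    (κ : Euc N → ℝ) (hκ : KernelHyp κ)
    (f : ℝ → Euc N → ℝ → ℝ) (hf : SatH0 T M₀ f)
    (u v : ℝ → Euc N → ℝ)
    (hu : IsSol κ f u (Set.Ici 0)) (hv : IsSol κ f v (Set.Ici 0))
    (hu0 : ∃ δ > 0, ∀ x, δ ≤ u 0 x) (hv0 : ∃ δ > 0, ∀ x, δ ≤ v 0 x) :
    (∀ t ≥ (0:ℝ), (∃ δ > 0, ∀ x, δ ≤ u t x) ∧ (∃ δ > 0, ∀ x, δ ≤ v t x)) ∧
    (∀ s t : ℝ, 0 ≤ s → s ≤ t → PartMetric (u t) (v t) ≤ PartMetric (u s) (v s)) := by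
  have hup := sol_pos hκ hf hu hu0
  have hvp := sol_pos hκ hf hv hv0
  have hup' : ∀ t ≥ 0, ∀ x, 0 < u t x := fun t ht x => by
    obtain ⟨δ, hδ, h⟩ := hup t ht
    exact hδ.trans_le (h x)
  have hvp' : ∀ t ≥ 0, ∀ x, 0 < v t x := fun t ht x => by
    obtain ⟨δ, hδ, h⟩ := hvp t ht
    exact hδ.trans_le (h x)
  refine ⟨fun t ht => ⟨hup t ht, hvp t ht⟩, fun s t hs hst => ?_⟩
  unfold PartMetric
  apply csInf_le_csInf
  · refine ⟨0, ?_⟩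
    rintro _ ⟨α, hα, rfl⟩
    exact Real.log_nonneg hα.1
  · apply Set.Nonempty.image
    obtain ⟨δ, hδ, h⟩ := hup s hs
    obtain ⟨δ', hδ', h'⟩ := hvp s hs
    obtain ⟨R, hR, hb⟩ := sol_bdd hu s
    obtain ⟨R', hR', hb'⟩ := sol_bdd hv s
    have hα : 1 ≤ 1 + R / δ' + R' / δ := by
      have : 0 < R / δ' := by positivity
      have : 0 < R' / δ := by positivity
      linarith
    refine ⟨1 + R / δ' + R' / δ, hα, fun x => ⟨?_, ?_⟩⟩
    · rw [div_le_iff₀ (by linarith)]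
      have h1 := (le_abs_self _).trans (hb s ⟨hs, le_rfl⟩ x)
      have h2 : R = δ' * (R / δ') := by field_simp
      have h3 : δ' * (R / δ') ≤ v s x * (1 + R / δ' + R' / δ) := by
        apply mul_le_mul (h' x) _ (by positivity) (hvp' s hs x).le
        have : 0 < R' / δ := by positivity
        linarith
      linarith
    · have h1 := (le_abs_self _).trans (hb' s ⟨hs, le_rfl⟩ x)
      have h2 : R' = (R' / δ) * δ := by field_simp
      have h3 : (R' / δ) * δ ≤ (1 + R / δ' + R' / δ) * u s x := by
        apply mul_le_mul _ (h x) hδ.le (by linarith)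
        have : 0 < R / δ' := by positivity
        linarith
      linarith
  · apply Set.image_mono
    rintro α ⟨hα, h⟩
    have hα0 : 0 < α := by linarith
    refine ⟨hα, fun x => ⟨?_, sol_cmp hκ hf hu hv hup' α hα s t hs hst (fun y => (h y).2) x⟩⟩
    rw [div_le_iff₀ hα0, mul_comm]
    refine sol_cmp hκ hf hv hu hvp' α hα s t hs hst (fun y => ?_) x
    have := (h y).1
    rwa [div_le_iff₀ hα0, mul_comm] at this

end
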